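/- arXiv:2202.00104 — 9 statements merged into one kernel-verified Lean document; each statement's English description precedes it below -/
import Mathlib

section
/- Let S and U be finite nonempty sets, and let W_P : S × U × S → ℝ^d satisfy W_P(s',s,u)_j ≥ 0 and Σ_{s'∈S} W_P(s',s,u)_j = 1 for every component j ∈ {1,…,d} and every (s,u) ∈ S × U. Let (c^x, a^x) and (c^y, a^y) be two teams of n agents (capabilities in ℝ^d, influence weights nonnegative summing to 1), and define P_x(s'|s,u) = Σ_{i=1}^n a^x_i ⟨c^x_i, W_P(s',s,u)⟩ and P_y(s'|s,u) = Σ_{i=1}^n a^y_i ⟨c^y_i, W_P(s',s,u)⟩. Then for every (s,u), Σ_{s'∈S} |P_x(s'|s,u) − P_y(s'|s,u)| ≤ d · Ψ, where Ψ = ‖Σ_i a^x_i (c^x_i − c^y_i)‖_∞ + ‖Σ_i (a^x_i − a^y_i) c^y_i‖_∞. -/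
/-- ℓ^∞ norm on ℝ^d. -/
noncomputable def linf {d : ℕ} (x : Fin d → ℝ) : ℝ := ⨆ j, |x j|

/-- Euclidean inner product on ℝ^d. -/
def dot {d : ℕ} (x y : Fin d → ℝ) : ℝ := ∑ j, x j * y j

/-- Total-variation style deviation of linear transition kernels between two team
compositions is bounded by `d * Ψ`. -/
theorem transition_deviation_bound {S U : Type*} [Fintype S] [Nonempty S] [Fintype U] [Nonempty U]
    {d n : ℕ}
    (WP : S → U → S → Fin d → ℝ)
    (hWPpos : ∀ s u s' j, 0 ≤ WP s u s' j)
    (hWPsum : ∀ s u (j : Fin d), ∑ s', WP s u s' j = 1)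
    (cx cy : Fin n → Fin d → ℝ) (ax ay : Fin n → ℝ)
    (haxpos : ∀ i, 0 ≤ ax i) (haxsum : ∑ i, ax i = 1)
    (haypos : ∀ i, 0 ≤ ay i) (haysum : ∑ i, ay i = 1)
    (Px Py : S → U → S → ℝ)
    (hPx : ∀ s u s', Px s u s' = ∑ i, ax i * dot (cx i) (WP s u s'))
    (hPy : ∀ s u s', Py s u s' = ∑ i, ay i * dot (cy i) (WP s u s')) :
    ∀ s u, ∑ s', |Px s u s' - Py s u s'| ≤ (d : ℝ) *
      (linf (fun j => ∑ i, ax i * (cx i j - cy i j)) +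
       linf (fun j => ∑ i, (ax i - ay i) * cy i j)) := by
  intro s u
  have hle : ∀ (x : Fin d → ℝ) j, |x j| ≤ linf x := fun x j =>
    le_ciSup (f := fun j => |x j|) (Set.finite_range _).bddAbove j
  set A : Fin d → ℝ := fun j => ∑ i, ax i * (cx i j - cy i j) with hA
  set B : Fin d → ℝ := fun j => ∑ i, (ax i - ay i) * cy i j with hB
  have key : ∀ s', Px s u s' - Py s u s' = ∑ j, (A j + B j) * WP s u s' j := by
    intro s'
    rw [hPx, hPy]
    simp only [hA, hB, dot, Finset.mul_sum]
    rw [Finset.sum_comm, Finset.sum_comm (f := fun i j => ay i * (cy i j * WP s u s' j)),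
      ← Finset.sum_sub_distrib]
    refine Finset.sum_congr rfl fun j _ => ?_
    rw [← Finset.sum_add_distrib, ← Finset.sum_sub_distrib, Finset.sum_mul]
    refine Finset.sum_congr rfl fun i _ => ?_
    ring
  calc ∑ s', |Px s u s' - Py s u s'|
      ≤ ∑ s', ∑ j, (linf A + linf B) * WP s u s' j := by
        refine Finset.sum_le_sum fun s' _ => ?_
        rw [key]
        refine (Finset.abs_sum_le_sum_abs _ _).trans (Finset.sum_le_sum fun j _ => ?_)
        rw [abs_mul, abs_of_nonneg (hWPpos s u s' j)]
        exact mul_le_mul_of_nonneg_right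
          ((abs_add_le _ _).trans (add_le_add (hle A j) (hle B j))) (hWPpos s u s' j)
    _ = (d : ℝ) * (linf A + linf B) := by
        rw [Finset.sum_comm]
        simp only [← Finset.mul_sum, hWPsum]
        simp [mul_comm]
end

section
/- Let S and U be finite nonempty sets and γ ∈ [0,1). Let P₁, P₂ be transition kernels on S × U (each P_j(·|s,u) a probability vector on S), R₁, R₂ : S → ℝ, and suppose Q₁, Q₂ : S × U → ℝ satisfy the Bellman optimality equations Q_j(s,u) = R_j(s) + γ Σ_{s'} P_j(s'|s,u) · max_{u'} Q_j(s',u') for j = 1,2. Suppose ε_R, ε_P, V_mid ∈ ℝ satisfy: |R₁(s) − R₂(s)| ≤ ε_R for all s; Σ_{s'} |P₁(s'|s,u) − P₂(s'|s,u)| ≤ ε_P for all (s,u); and |max_{u'} Q₂(s,u') − V_mid| ≤ V_mid for all s. Then max_{s,u} |Q₁(s,u) − Q₂(s,u)| ≤ (ε_R + γ ε_P V_mid)/(1 − γ). -/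
/-- If two optimal Q-functions satisfy Bellman optimality equations for rewards and
kernels that are `ε_R`- and `ε_P`-close, then they are uniformly
`(ε_R + γ ε_P V_mid)/(1-γ)`-close. -/
theorem bellman_optimal_deviation {S U : Type*} [Fintype S] [Nonempty S] [Fintype U] [Nonempty U]
    (γ : ℝ) (hγ0 : 0 ≤ γ) (hγ1 : γ < 1)
    (P₁ P₂ : S → U → S → ℝ)
    (hP₁pos : ∀ s u s', 0 ≤ P₁ s u s') (hP₁sum : ∀ s u, ∑ s', P₁ s u s' = 1)
    (hP₂pos : ∀ s u s', 0 ≤ P₂ s u s') (hP₂sum : ∀ s u, ∑ s', P₂ s u s' = 1)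
    (R₁ R₂ : S → ℝ) (Q₁ Q₂ : S → U → ℝ)
    (hQ₁ : ∀ s u, Q₁ s u = R₁ s + γ * ∑ s', P₁ s u s' * (⨆ u', Q₁ s' u'))
    (hQ₂ : ∀ s u, Q₂ s u = R₂ s + γ * ∑ s', P₂ s u s' * (⨆ u', Q₂ s' u'))
    (εR εP Vmid : ℝ)
    (hR : ∀ s, |R₁ s - R₂ s| ≤ εR)
    (hP : ∀ s u, ∑ s', |P₁ s u s' - P₂ s u s'| ≤ εP)
    (hV : ∀ s, |(⨆ u', Q₂ s u') - Vmid| ≤ Vmid) :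
    (⨆ s, ⨆ u, |Q₁ s u - Q₂ s u|) ≤ (εR + γ * εP * Vmid) / (1 - γ) := by
  set D : ℝ := ⨆ s, ⨆ u, |Q₁ s u - Q₂ s u| with hD
  have hle : ∀ s u, |Q₁ s u - Q₂ s u| ≤ D := fun s u =>
    (le_ciSup (f := fun u => |Q₁ s u - Q₂ s u|) (Set.finite_range _).bddAbove u).trans
      (le_ciSup (f := fun s => ⨆ u, |Q₁ s u - Q₂ s u|) (Set.finite_range _).bddAbove s)
  have hVV : ∀ s, |(⨆ u', Q₁ s u') - (⨆ u', Q₂ s u')| ≤ D := by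
    intro s
    have h1 : (⨆ u', Q₁ s u') ≤ (⨆ u', Q₂ s u') + D := ciSup_le fun u => by
      have h := le_ciSup (f := fun u => Q₂ s u) (Set.finite_range _).bddAbove u
      have h' := (abs_le.1 (hle s u)).2
      linarith
    have h2 : (⨆ u', Q₂ s u') ≤ (⨆ u', Q₁ s u') + D := ciSup_le fun u => by
      have h := le_ciSup (f := fun u => Q₁ s u) (Set.finite_range _).bddAbove u
      have h' := (abs_le.1 (hle s u)).1
      linarith
    exact abs_le.2 ⟨by linarith, by linarith⟩
  have hV0 : 0 ≤ Vmid := (abs_nonneg _).trans (hV (Classical.arbitrary S))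
  have key : ∀ s u, |Q₁ s u - Q₂ s u| ≤ εR + γ * (D + εP * Vmid) := by
    intro s u
    have e : Q₁ s u - Q₂ s u = (R₁ s - R₂ s) +
        γ * (∑ s', P₁ s u s' * ((⨆ u', Q₁ s' u') - (⨆ u', Q₂ s' u')) +
          ∑ s', (P₁ s u s' - P₂ s u s') * ((⨆ u', Q₂ s' u') - Vmid)) := by
      rw [hQ₁ s u, hQ₂ s u]
      simp only [mul_sub, sub_mul, Finset.sum_sub_distrib, ← Finset.sum_mul, hP₁sum, hP₂sum]
      ring
    have a1 : |∑ s', P₁ s u s' * ((⨆ u', Q₁ s' u') - (⨆ u', Q₂ s' u'))| ≤ D := by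
      refine (Finset.abs_sum_le_sum_abs _ _).trans ?_
      calc _ ≤ ∑ s', P₁ s u s' * D := Finset.sum_le_sum fun s' _ => by
            rw [abs_mul, abs_of_nonneg (hP₁pos s u s')]
            exact mul_le_mul_of_nonneg_left (hVV s') (hP₁pos s u s')
        _ = D := by rw [← Finset.sum_mul, hP₁sum, one_mul]
    have a2 : |∑ s', (P₁ s u s' - P₂ s u s') * ((⨆ u', Q₂ s' u') - Vmid)| ≤ εP * Vmid := by
      refine (Finset.abs_sum_le_sum_abs _ _).trans ?_
      calc _ ≤ ∑ s', |P₁ s u s' - P₂ s u s'| * Vmid := Finset.sum_le_sum fun s' _ => by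
            rw [abs_mul]
            exact mul_le_mul_of_nonneg_left (hV s') (abs_nonneg _)
        _ ≤ εP * Vmid := by
            rw [← Finset.sum_mul]
            exact mul_le_mul_of_nonneg_right (hP s u) hV0
    rw [e]
    refine (abs_add_le _ _).trans (add_le_add (hR s) ?_)
    rw [abs_mul, abs_of_nonneg hγ0]
    exact mul_le_mul_of_nonneg_left ((abs_add_le _ _).trans (add_le_add a1 a2)) hγ0
  have hDle : D ≤ εR + γ * (D + εP * Vmid) := ciSup_le fun s => ciSup_le fun u => key s u
  rw [le_div_iff₀ (by linarith)]
  linarith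
end

section
/- (Generalisation between team compositions.) Let S, U be finite nonempty sets, γ ∈ (0,1), φ : S → ℝ^k, W_R ∈ ℝ^{d×k}, and W_P : S × U × S → ℝ^d with each component j giving a probability distribution over next states. Let (c^x, a^x) and (c^y, a^y) be two teams of n agents with linear rewards R_x, R_y and linear transition kernels P_x, P_y (each assumed to be a probability vector in s'). Let Q_x, Q_y : S × U → ℝ satisfy the Bellman optimality equations for (R_x, P_x) and (R_y, P_y) respectively, with Q_y(s,u) ≥ 0 for all (s,u). Set s_max = max_s ‖W_R φ(s)‖₁, V_mid = (1/2) · max_{s,u} Q_y(s,u), Ψ = ‖Σ_i a^x_i (c^x_i − c^y_i)‖_∞ + ‖Σ_i (a^x_i − a^y_i) c^y_i‖_∞, and for any initial distribution ρ on S let V*_x = Σ_s ρ(s) max_u Q_x(s,u) and V*_y = Σ_s ρ(s) max_u Q_y(s,u). Then |V*_x − V*_y| ≤ ((s_max + γ d V_mid)/(γ(1 − γ))) · Ψ. -/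
/-- ℓ¹ norm on ℝ^k. -/
def l1 {k : ℕ} (x : Fin k → ℝ) : ℝ := ∑ j, |x j|

/-- Generalisation between team compositions: the optimal values of two teams under
linear dynamics differ by at most `((s_max + γ d V_mid)/(γ(1-γ))) Ψ`. -/
theorem generalisation_between_team_compositions
    {S U : Type*} [Fintype S] [Nonempty S] [Fintype U] [Nonempty U]
    {k d n : ℕ} (γ : ℝ) (hγ0 : 0 < γ) (hγ1 : γ < 1)
    (φ : S → Fin k → ℝ) (WR : Matrix (Fin d) (Fin k) ℝ)
    (WP : S → U → S → Fin d → ℝ)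
    (hWPpos : ∀ s u s' j, 0 ≤ WP s u s' j)
    (hWPsum : ∀ s u (j : Fin d), ∑ s', WP s u s' j = 1)
    (cx cy : Fin n → Fin d → ℝ) (ax ay : Fin n → ℝ)
    (haxpos : ∀ i, 0 ≤ ax i) (haxsum : ∑ i, ax i = 1)
    (haypos : ∀ i, 0 ≤ ay i) (haysum : ∑ i, ay i = 1)
    (Rx Ry : S → ℝ) (Px Py : S → U → S → ℝ)
    (hRx : ∀ s, Rx s = ∑ i, ax i * dot (cx i) (WR.mulVec (φ s)))
    (hRy : ∀ s, Ry s = ∑ i, ay i * dot (cy i) (WR.mulVec (φ s)))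
    (hPx : ∀ s u s', Px s u s' = ∑ i, ax i * dot (cx i) (WP s u s'))
    (hPy : ∀ s u s', Py s u s' = ∑ i, ay i * dot (cy i) (WP s u s'))
    (hPxpos : ∀ s u s', 0 ≤ Px s u s') (hPxsum : ∀ s u, ∑ s', Px s u s' = 1)
    (hPypos : ∀ s u s', 0 ≤ Py s u s') (hPysum : ∀ s u, ∑ s', Py s u s' = 1)
    (Qx Qy : S → U → ℝ)
    (hQx : ∀ s u, Qx s u = Rx s + γ * ∑ s', Px s u s' * (⨆ u', Qx s' u'))
    (hQy : ∀ s u, Qy s u = Ry s + γ * ∑ s', Py s u s' * (⨆ u', Qy s' u'))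
    (hQypos : ∀ s u, 0 ≤ Qy s u)
    (ρ : S → ℝ) (hρpos : ∀ s, 0 ≤ ρ s) (hρsum : ∑ s, ρ s = 1) :
    |(∑ s, ρ s * (⨆ u, Qx s u)) - ∑ s, ρ s * (⨆ u, Qy s u)| ≤
      ((⨆ s, l1 (WR.mulVec (φ s))) + γ * d * ((1/2) * ⨆ s, ⨆ u, Qy s u)) / (γ * (1 - γ)) *
      (linf (fun j => ∑ i, ax i * (cx i j - cy i j)) +
       linf (fun j => ∑ i, (ax i - ay i) * cy i j)) := by
  classical
  set Ψ := linf (fun j => ∑ i, ax i * (cx i j - cy i j)) +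
       linf (fun j => ∑ i, (ax i - ay i) * cy i j) with hΨ
  set M := ⨆ s, l1 (WR.mulVec (φ s)) with hM
  set B := ⨆ s, ⨆ u, Qy s u with hB
  have hlinf : ∀ (x : Fin d → ℝ) j, |x j| ≤ linf x := fun x j =>
    le_ciSup (f := fun j => |x j|) (Set.finite_range _).bddAbove j
  have hlinf0 : ∀ (x : Fin d → ℝ), 0 ≤ linf x := fun x =>
    Real.iSup_nonneg (fun j => abs_nonneg (x j))
  have hΨ0 : 0 ≤ Ψ := add_nonneg (hlinf0 _) (hlinf0 _)
  let w : Fin d → ℝ := fun j => (∑ i, ax i * cx i j) - ∑ i, ay i * cy i j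
  have hw : ∀ j, |w j| ≤ Ψ := by
    intro j
    have e : w j = (∑ i, ax i * (cx i j - cy i j)) + ∑ i, (ax i - ay i) * cy i j := by
      simp only [w, ← Finset.sum_add_distrib, ← Finset.sum_sub_distrib]
      exact Finset.sum_congr rfl (fun i _ => by ring)
    rw [e]
    exact (abs_add_le _ _).trans (add_le_add
      (hlinf (fun j => ∑ i, ax i * (cx i j - cy i j)) j)
      (hlinf (fun j => ∑ i, (ax i - ay i) * cy i j) j))
  have hdot : ∀ (a : Fin n → ℝ) (c : Fin n → Fin d → ℝ) (v : Fin d → ℝ),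
      ∑ i, a i * dot (c i) v = ∑ j, (∑ i, a i * c i j) * v j := by
    intro a c v
    simp only [dot, Finset.mul_sum, Finset.sum_mul]
    rw [Finset.sum_comm]
    exact Finset.sum_congr rfl (fun j _ => Finset.sum_congr rfl (fun i _ => by ring))
  have hdiff : ∀ v : Fin d → ℝ,
      |∑ i, ax i * dot (cx i) v - ∑ i, ay i * dot (cy i) v| ≤ Ψ * ∑ j, |v j| := by
    intro v
    rw [hdot, hdot, ← Finset.sum_sub_distrib, Finset.mul_sum]
    refine (Finset.abs_sum_le_sum_abs _ _).trans (Finset.sum_le_sum fun j _ => ?_)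
    rw [← sub_mul, abs_mul]
    exact mul_le_mul_of_nonneg_right (hw j) (abs_nonneg _)
  have hR : ∀ s, |Rx s - Ry s| ≤ Ψ * M := by
    intro s
    rw [hRx, hRy]
    refine (hdiff _).trans (mul_le_mul_of_nonneg_left ?_ hΨ0)
    exact le_ciSup (f := fun s => l1 (WR.mulVec (φ s))) (Set.finite_range _).bddAbove s
  have hP : ∀ s u, ∑ s', |Px s u s' - Py s u s'| ≤ Ψ * d := by
    intro s u
    calc ∑ s', |Px s u s' - Py s u s'| ≤ ∑ s', Ψ * ∑ j, WP s u s' j := by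
          refine Finset.sum_le_sum fun s' _ => ?_
          rw [hPx, hPy]
          refine (hdiff _).trans (le_of_eq ?_)
          congr 1
          exact Finset.sum_congr rfl fun j _ => abs_of_nonneg (hWPpos _ _ _ _)
      _ = Ψ * d := by
          rw [← Finset.mul_sum, Finset.sum_comm]
          simp [hWPsum]
  let Vx : S → ℝ := fun s => ⨆ u, Qx s u
  let Vy : S → ℝ := fun s => ⨆ u, Qy s u
  have hVy0 : ∀ s, 0 ≤ Vy s := fun s => Real.iSup_nonneg (hQypos s)
  have hVyB : ∀ s, Vy s ≤ B := fun s => le_ciSup (f := Vy) (Set.finite_range _).bddAbove s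
  have hB0 : 0 ≤ B := Real.iSup_nonneg hVy0
  have hM0 : 0 ≤ M := Real.iSup_nonneg fun s => Finset.sum_nonneg fun j _ => abs_nonneg _
  obtain ⟨t, ht⟩ := Finite.exists_max (fun s => |Vx s - Vy s|)
  set D := |Vx t - Vy t| with hD
  have ht' : ∀ s, |Vx s - Vy s| ≤ D := ht
  set K := M + γ * d * ((1/2) * B) with hK
  have hK0 : 0 ≤ K := by positivity
  have hQ : ∀ s u, |Qx s u - Qy s u| ≤ K * Ψ + γ * D := by
    intro s u
    have e : Qx s u - Qy s u = (Rx s - Ry s) + γ * (∑ s', Px s u s' * (Vx s' - Vy s'))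
        + γ * ∑ s', (Px s u s' - Py s u s') * (Vy s' - B / 2) := by
      have h0 : ∑ s', (Px s u s' - Py s u s') * (Vy s' - B / 2)
          = ∑ s', Px s u s' * Vy s' - ∑ s', Py s u s' * Vy s' := by
        have h1 : ∑ s', (Px s u s' - Py s u s') * (B / 2) = 0 := by
          rw [← Finset.sum_mul, Finset.sum_sub_distrib, hPxsum, hPysum]; simp
        simp only [mul_sub, Finset.sum_sub_distrib, h1]
        simp only [sub_mul, Finset.sum_sub_distrib, sub_zero]
      rw [h0, hQx, hQy]
      simp only [mul_sub, Finset.sum_sub_distrib, Vx, Vy]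
      ring
    have h2 : |∑ s', Px s u s' * (Vx s' - Vy s')| ≤ D := by
      calc _ ≤ ∑ s', |Px s u s' * (Vx s' - Vy s')| := Finset.abs_sum_le_sum_abs _ _
        _ ≤ ∑ s', Px s u s' * D := Finset.sum_le_sum fun s' _ => by
            rw [abs_mul, abs_of_nonneg (hPxpos s u s')]
            exact mul_le_mul_of_nonneg_left (ht' s') (hPxpos s u s')
        _ = D := by rw [← Finset.sum_mul, hPxsum, one_mul]
    have h3 : |∑ s', (Px s u s' - Py s u s') * (Vy s' - B / 2)| ≤ Ψ * d * (B / 2) := by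
      calc _ ≤ ∑ s', |(Px s u s' - Py s u s') * (Vy s' - B / 2)| :=
            Finset.abs_sum_le_sum_abs _ _
        _ ≤ ∑ s', |Px s u s' - Py s u s'| * (B / 2) := Finset.sum_le_sum fun s' _ => by
            rw [abs_mul]
            refine mul_le_mul_of_nonneg_left ?_ (abs_nonneg _)
            rw [abs_le]
            constructor <;> linarith [hVy0 s', hVyB s']
        _ ≤ _ := by
            rw [← Finset.sum_mul]
            exact mul_le_mul_of_nonneg_right (hP s u) (by linarith)
    rw [e]
    refine (abs_add_three _ _ _).trans ?_
    rw [abs_mul, abs_mul, abs_of_pos hγ0]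
    have h4 := mul_le_mul_of_nonneg_left h2 hγ0.le
    have h5 := mul_le_mul_of_nonneg_left h3 hγ0.le
    have h6 := hR s
    have h7 : K * Ψ = Ψ * M + γ * (Ψ * d * (B / 2)) := by rw [hK]; ring
    linarith
  have hDle : D ≤ K * Ψ + γ * D := by
    have hx : ∀ u, Qx t u ≤ Vx t := fun u =>
      le_ciSup (f := Qx t) (Set.finite_range _).bddAbove u
    have hy : ∀ u, Qy t u ≤ Vy t := fun u =>
      le_ciSup (f := Qy t) (Set.finite_range _).bddAbove u
    have h1 : Vx t ≤ Vy t + (K * Ψ + γ * D) := ciSup_le fun u => by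
      linarith [(abs_le.1 (hQ t u)).2, hy u]
    have h2 : Vy t ≤ Vx t + (K * Ψ + γ * D) := ciSup_le fun u => by
      linarith [(abs_le.1 (hQ t u)).1, hx u]
    exact abs_le.2 ⟨by linarith, by linarith⟩
  have hg : 0 < 1 - γ := by linarith
  have hKΨ : 0 ≤ K * Ψ := mul_nonneg hK0 hΨ0
  have hD0 : 0 ≤ D := abs_nonneg _
  have hDfin : D ≤ K / (γ * (1 - γ)) * Ψ := by
    rw [div_mul_eq_mul_div, le_div_iff₀ (by positivity)]
    have h1 : D * (1 - γ) ≤ K * Ψ := by linarith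
    have h2 : 0 ≤ D * (1 - γ) := mul_nonneg hD0 hg.le
    nlinarith
  refine le_trans ?_ hDfin
  rw [← Finset.sum_sub_distrib]
  calc _ ≤ ∑ s, |ρ s * Vx s - ρ s * Vy s| := Finset.abs_sum_le_sum_abs _ _
    _ ≤ ∑ s, ρ s * D := Finset.sum_le_sum fun s _ => by
        rw [← mul_sub, abs_mul, abs_of_nonneg (hρpos s)]
        exact mul_le_mul_of_nonneg_left (ht' s) (hρpos s)
    _ = D := by rw [← Finset.sum_mul, hρsum, one_mul]
end

section
/- (Change in optimal value under agent substitution.) In the linear-dynamics setting, let (c, a) be a team of n agents and let (c', a) be the team obtained by replacing the capability of a single agent i by c'_i with ‖c'_i − c_i‖_∞ ≤ ε_C, keeping all other capabilities and all influence weights unchanged. Let Q, Q' satisfy the Bellman optimality equations for the linear dynamics of (c,a) and (c',a) respectively, with Q' ≥ 0, and set V_mid = (1/2) max_{s,u} Q'(s,u), s_max = max_s ‖W_R φ(s)‖₁. Then for any initial distribution ρ, the optimal values satisfy |V*_{(c',a)} − V*_{(c,a)}| ≤ (s_max + γ d V_mid) · a_i · ε_C / (γ(1 − γ)). -/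
/-- Change in optimal value as a result of substituting a single agent's capability
by an `ε_C`-close one (in ℓ^∞), keeping all influence weights unchanged. -/
theorem agent_substitution_bound
    {S U : Type*} [Fintype S] [Nonempty S] [Fintype U] [Nonempty U]
    {k d n : ℕ} (γ : ℝ) (hγ0 : 0 < γ) (hγ1 : γ < 1)
    (φ : S → Fin k → ℝ) (WR : Matrix (Fin d) (Fin k) ℝ)
    (WP : S → U → S → Fin d → ℝ)
    (hWPpos : ∀ s u s' j, 0 ≤ WP s u s' j)
    (hWPsum : ∀ s u (j : Fin d), ∑ s', WP s u s' j = 1)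
    (c c' : Fin n → Fin d → ℝ) (a : Fin n → ℝ)
    (hapos : ∀ i, 0 ≤ a i) (hasum : ∑ i, a i = 1)
    (i : Fin n) (εC : ℝ)
    (hsub : ∀ j, j ≠ i → c' j = c j)
    (hclose : linf (fun m => c' i m - c i m) ≤ εC)
    (R R' : S → ℝ) (P P' : S → U → S → ℝ)
    (hR : ∀ s, R s = ∑ j, a j * dot (c j) (WR.mulVec (φ s)))
    (hR' : ∀ s, R' s = ∑ j, a j * dot (c' j) (WR.mulVec (φ s)))
    (hP : ∀ s u s', P s u s' = ∑ j, a j * dot (c j) (WP s u s'))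
    (hP' : ∀ s u s', P' s u s' = ∑ j, a j * dot (c' j) (WP s u s'))
    (hPpos : ∀ s u s', 0 ≤ P s u s') (hPsum : ∀ s u, ∑ s', P s u s' = 1)
    (hP'pos : ∀ s u s', 0 ≤ P' s u s') (hP'sum : ∀ s u, ∑ s', P' s u s' = 1)
    (Q Q' : S → U → ℝ)
    (hQ : ∀ s u, Q s u = R s + γ * ∑ s', P s u s' * (⨆ u', Q s' u'))
    (hQ' : ∀ s u, Q' s u = R' s + γ * ∑ s', P' s u s' * (⨆ u', Q' s' u'))
    (hQ'pos : ∀ s u, 0 ≤ Q' s u)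
    (ρ : S → ℝ) (hρpos : ∀ s, 0 ≤ ρ s) (hρsum : ∑ s, ρ s = 1) :
    |(∑ s, ρ s * (⨆ u, Q' s u)) - ∑ s, ρ s * (⨆ u, Q s u)| ≤
      ((⨆ s, l1 (WR.mulVec (φ s))) + γ * d * ((1/2) * ⨆ s, ⨆ u, Q' s u)) * a i * εC /
        (γ * (1 - γ)) := by
  have bdd : ∀ f : U → ℝ, BddAbove (Set.range f) := fun f => (Set.finite_range f).bddAbove
  have bddS : ∀ f : S → ℝ, BddAbove (Set.range f) := fun f => (Set.finite_range f).bddAbove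
  have hε0 : 0 ≤ εC := le_trans (Real.iSup_nonneg fun _ => abs_nonneg _) hclose
  have hεj : ∀ m, |c' i m - c i m| ≤ εC := fun m =>
    le_trans (le_ciSup (f := fun m => |c' i m - c i m|) (Set.finite_range _).bddAbove m) hclose
  have hdiff : ∀ x : Fin d → ℝ, (∑ j, a j * dot (c' j) x) - (∑ j, a j * dot (c j) x)
      = a i * ∑ m, (c' i m - c i m) * x m := by
    intro x
    rw [← Finset.sum_sub_distrib, Finset.sum_eq_single i]
    · simp only [dot]
      rw [← mul_sub, ← Finset.sum_sub_distrib]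
      congr 1
      exact Finset.sum_congr rfl fun m _ => by ring
    · intro j _ hj
      rw [hsub j hj, sub_self]
    · intro h
      exact absurd (Finset.mem_univ i) h
  have hdl : ∀ x : Fin d → ℝ, |(∑ j, a j * dot (c' j) x) - (∑ j, a j * dot (c j) x)|
      ≤ a i * (εC * l1 x) := by
    intro x
    rw [hdiff, abs_mul, abs_of_nonneg (hapos i)]
    refine mul_le_mul_of_nonneg_left ?_ (hapos i)
    refine (Finset.abs_sum_le_sum_abs _ _).trans ?_
    rw [l1, Finset.mul_sum]
    refine Finset.sum_le_sum fun m _ => ?_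
    rw [abs_mul]
    exact mul_le_mul_of_nonneg_right (hεj m) (abs_nonneg _)
  set smax := ⨆ s, l1 (WR.mulVec (φ s)) with hsmax
  set M := ⨆ s, ⨆ u, Q' s u with hM
  have hV0 : ∀ s, 0 ≤ ⨆ u, Q' s u := fun s => Real.iSup_nonneg fun u => hQ'pos s u
  have hVM : ∀ s, (⨆ u, Q' s u) ≤ M := fun s =>
    le_ciSup (f := fun s => ⨆ u, Q' s u) (bddS _) s
  have hM0 : 0 ≤ M := Real.iSup_nonneg hV0
  have hs0 : 0 ≤ smax := Real.iSup_nonneg fun s => Finset.sum_nonneg fun _ _ => abs_nonneg _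
  have hRd : ∀ s, |R' s - R s| ≤ smax * a i * εC := by
    intro s
    rw [hR, hR']
    refine (hdl _).trans ?_
    have h1 : l1 (WR.mulVec (φ s)) ≤ smax :=
      le_ciSup (f := fun s => l1 (WR.mulVec (φ s))) (bddS _) s
    have h2 := mul_le_mul_of_nonneg_left h1 (mul_nonneg (hapos i) hε0)
    linarith
  have hPl : ∀ s u, ∑ s', |P' s u s' - P s u s'| ≤ a i * (εC * d) := by
    intro s u
    have h1 : ∑ s', |P' s u s' - P s u s'| ≤ ∑ s', a i * (εC * l1 (WP s u s')) :=
      Finset.sum_le_sum fun s' _ => by rw [hP, hP']; exact hdl _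
    refine h1.trans (le_of_eq ?_)
    rw [← Finset.mul_sum, ← Finset.mul_sum]
    congr 2
    simp only [l1]
    rw [Finset.sum_comm]
    simp only [abs_of_nonneg (hWPpos _ _ _ _), hWPsum]
    simp
  have hPd : ∀ s u, |∑ s', (P' s u s' - P s u s') * (⨆ u', Q' s' u')|
      ≤ a i * (εC * d) * ((1/2) * M) := by
    intro s u
    have h1 : ∑ s', (P' s u s' - P s u s') * (⨆ u', Q' s' u')
        = ∑ s', (P' s u s' - P s u s') * ((⨆ u', Q' s' u') - (1/2) * M) := by
      simp only [mul_sub]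
      rw [Finset.sum_sub_distrib, ← Finset.sum_mul, Finset.sum_sub_distrib, hPsum, hP'sum]
      ring
    rw [h1]
    refine (Finset.abs_sum_le_sum_abs _ _).trans ?_
    refine le_trans ?_ (mul_le_mul_of_nonneg_right (hPl s u) (by positivity))
    rw [Finset.sum_mul]
    refine Finset.sum_le_sum fun s' _ => ?_
    rw [abs_mul]
    refine mul_le_mul_of_nonneg_left ?_ (abs_nonneg _)
    rw [abs_le]
    constructor <;> linarith [hV0 s', hVM s']
  obtain ⟨p, hp⟩ := Finite.exists_max (fun p : S × U => |Q' p.1 p.2 - Q p.1 p.2|)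
  set D := |Q' p.1 p.2 - Q p.1 p.2| with hD
  have hQD : ∀ s u, |Q' s u - Q s u| ≤ D := fun s u => hp (s, u)
  have hVD : ∀ s, |(⨆ u, Q' s u) - ⨆ u, Q s u| ≤ D := by
    intro s
    rw [abs_sub_le_iff]
    constructor
    · rw [sub_le_iff_le_add]
      refine ciSup_le fun u => ?_
      linarith [(abs_le.mp (hQD s u)).2, le_ciSup (bdd (Q s)) u]
    · rw [sub_le_iff_le_add]
      refine ciSup_le fun u => ?_
      linarith [(abs_le.mp (hQD s u)).1, le_ciSup (bdd (Q' s)) u]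
  have hw : ∀ w : S → ℝ, (∀ s, 0 ≤ w s) → ∑ s, w s = 1 →
      |∑ s, w s * ((⨆ u, Q' s u) - ⨆ u, Q s u)| ≤ D := by
    intro w hw0 hw1
    refine (Finset.abs_sum_le_sum_abs _ _).trans ?_
    calc ∑ s, |w s * ((⨆ u, Q' s u) - ⨆ u, Q s u)| ≤ ∑ s, w s * D :=
          Finset.sum_le_sum fun s _ => by
            rw [abs_mul, abs_of_nonneg (hw0 s)]
            exact mul_le_mul_of_nonneg_left (hVD s) (hw0 s)
      _ = D := by rw [← Finset.sum_mul, hw1, one_mul]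
  set B := (smax + γ * d * ((1/2) * M)) * a i * εC with hB
  have hB0 : 0 ≤ B := by
    have := hapos i
    positivity
  have hDB : D ≤ B + γ * D := by
    have e : Q' p.1 p.2 - Q p.1 p.2 = (R' p.1 - R p.1)
        + γ * (∑ s', (P' p.1 p.2 s' - P p.1 p.2 s') * (⨆ u', Q' s' u'))
        + γ * (∑ s', P p.1 p.2 s' * ((⨆ u', Q' s' u') - ⨆ u', Q s' u')) := by
      rw [hQ' p.1 p.2, hQ p.1 p.2]
      simp only [sub_mul, mul_sub, Finset.sum_sub_distrib]
      ring
    have h1 := abs_le.mp (hRd p.1)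
    have h2 := abs_le.mp (hPd p.1 p.2)
    have h3 := abs_le.mp (hw _ (hPpos p.1 p.2) (hPsum p.1 p.2))
    have h2a := mul_le_mul_of_nonneg_left h2.1 hγ0.le
    have h2b := mul_le_mul_of_nonneg_left h2.2 hγ0.le
    have h3a := mul_le_mul_of_nonneg_left h3.1 hγ0.le
    have h3b := mul_le_mul_of_nonneg_left h3.2 hγ0.le
    have hBe : B = smax * a i * εC + γ * (a i * (εC * d) * ((1/2) * M)) := by
      rw [hB]; ring
    rw [hD, e, abs_le, ← e, ← hD, hBe]
    constructor <;> linarith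
  have hg : 0 < 1 - γ := by linarith
  have hfin : D ≤ B / (γ * (1 - γ)) := by
    rw [le_div_iff₀ (by positivity)]
    have h1 : D * (1 - γ) ≤ B := by linarith
    have h2 : 0 ≤ D * (1 - γ) := mul_nonneg (abs_nonneg _) hg.le
    nlinarith
  rw [← Finset.sum_sub_distrib]
  simp only [← mul_sub]
  exact (hw ρ hρpos hρsum).trans hfin
end

section
/- Let S, U be finite nonempty sets and γ ∈ [0,1). Let P₁, P₂ be transition kernels, R₁, R₂ : S → ℝ, and let Q₂ satisfy the Bellman optimality equation for (R₂, P₂). Let π : S → U be a greedy policy for Q₂, i.e. Q₂(s, π(s)) = max_u Q₂(s,u) for all s, and let Q^π satisfy the policy-evaluation Bellman equation under (R₁, P₁): Q^π(s,u) = R₁(s) + γ Σ_{s'} P₁(s'|s,u) · Q^π(s', π(s')) for all (s,u). If |R₁(s) − R₂(s)| ≤ ε_R for all s, Σ_{s'}|P₁(s'|s,u) − P₂(s'|s,u)| ≤ ε_P for all (s,u), and |max_{u'} Q₂(s,u') − V_mid| ≤ V_mid for all s, then max_{s,u} |Q₂(s,u) − Q^π(s,u)| ≤ (ε_R + γ ε_P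 V_mid)/(1 − γ). -/
/-- Evaluating the greedy policy of `Q₂` under nearby dynamics `(R₁, P₁)` deviates
from `Q₂` by at most `(ε_R + γ ε_P V_mid)/(1-γ)` uniformly. -/
theorem bellman_policy_transfer_deviation
    {S U : Type*} [Fintype S] [Nonempty S] [Fintype U] [Nonempty U]
    (γ : ℝ) (hγ0 : 0 ≤ γ) (hγ1 : γ < 1)
    (P₁ P₂ : S → U → S → ℝ)
    (hP₁pos : ∀ s u s', 0 ≤ P₁ s u s') (hP₁sum : ∀ s u, ∑ s', P₁ s u s' = 1)
    (hP₂pos : ∀ s u s', 0 ≤ P₂ s u s') (hP₂sum : ∀ s u, ∑ s', P₂ s u s' = 1)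
    (R₁ R₂ : S → ℝ) (Q₂ : S → U → ℝ)
    (hQ₂ : ∀ s u, Q₂ s u = R₂ s + γ * ∑ s', P₂ s u s' * (⨆ u', Q₂ s' u'))
    (π : S → U) (hπ : ∀ s, Q₂ s (π s) = ⨆ u, Q₂ s u)
    (Qπ : S → U → ℝ)
    (hQπ : ∀ s u, Qπ s u = R₁ s + γ * ∑ s', P₁ s u s' * Qπ s' (π s'))
    (εR εP Vmid : ℝ)
    (hR : ∀ s, |R₁ s - R₂ s| ≤ εR)
    (hP : ∀ s u, ∑ s', |P₁ s u s' - P₂ s u s'| ≤ εP)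
    (hV : ∀ s, |(⨆ u', Q₂ s u') - Vmid| ≤ Vmid) :
    (⨆ s, ⨆ u, |Q₂ s u - Qπ s u|) ≤ (εR + γ * εP * Vmid) / (1 - γ) := by
  obtain ⟨⟨s0, u0⟩, hmax⟩ := Finite.exists_max (fun p : S × U => |Q₂ p.1 p.2 - Qπ p.1 p.2|)
  simp only [Prod.forall] at hmax
  have hdec : Q₂ s0 u0 - Qπ s0 u0 = -(R₁ s0 - R₂ s0)
      + γ * (-∑ s', (P₁ s0 u0 s' - P₂ s0 u0 s') * ((⨆ u', Q₂ s' u') - Vmid))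
      + γ * ∑ s', P₁ s0 u0 s' * (Q₂ s' (π s') - Qπ s' (π s')) := by
    have h1 : ∑ s', (P₁ s0 u0 s' - P₂ s0 u0 s') * ((⨆ u', Q₂ s' u') - Vmid)
        = ∑ s', P₁ s0 u0 s' * (⨆ u', Q₂ s' u') - ∑ s', P₂ s0 u0 s' * (⨆ u', Q₂ s' u') := by
      have : ∑ s', (P₁ s0 u0 s' - P₂ s0 u0 s') * ((⨆ u', Q₂ s' u') - Vmid)
        = ∑ s', P₁ s0 u0 s' * (⨆ u', Q₂ s' u') - ∑ s', P₂ s0 u0 s' * (⨆ u', Q₂ s' u')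
          - ((∑ s', P₁ s0 u0 s') - ∑ s', P₂ s0 u0 s') * Vmid := by
        rw [← Finset.sum_sub_distrib, ← Finset.sum_sub_distrib, Finset.sum_mul,
          ← Finset.sum_sub_distrib]
        exact Finset.sum_congr rfl fun s' _ => by ring
      rw [this, hP₁sum, hP₂sum]
      ring
    have h2 : ∑ s', P₁ s0 u0 s' * (Q₂ s' (π s') - Qπ s' (π s'))
        = ∑ s', P₁ s0 u0 s' * (⨆ u', Q₂ s' u') - ∑ s', P₁ s0 u0 s' * Qπ s' (π s') := by
      rw [← Finset.sum_sub_distrib]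
      exact Finset.sum_congr rfl fun s' _ => by rw [hπ]; ring
    rw [h1, h2, hQ₂ s0 u0, hQπ s0 u0]
    ring
  have hVm : 0 ≤ Vmid := (abs_nonneg _).trans (hV s0)
  have hA : |∑ s', (P₁ s0 u0 s' - P₂ s0 u0 s') * ((⨆ u', Q₂ s' u') - Vmid)| ≤ εP * Vmid := by
    refine (Finset.abs_sum_le_sum_abs _ _).trans ?_
    refine le_trans ?_ (mul_le_mul_of_nonneg_right (hP s0 u0) hVm)
    rw [Finset.sum_mul]
    refine Finset.sum_le_sum fun s' _ => ?_
    rw [abs_mul]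
    exact mul_le_mul_of_nonneg_left (hV s') (abs_nonneg _)
  have hB : |∑ s', P₁ s0 u0 s' * (Q₂ s' (π s') - Qπ s' (π s'))| ≤ |Q₂ s0 u0 - Qπ s0 u0| := by
    refine (Finset.abs_sum_le_sum_abs _ _).trans ?_
    rw [← one_mul |Q₂ s0 u0 - Qπ s0 u0|, ← hP₁sum s0 u0, Finset.sum_mul]
    refine Finset.sum_le_sum fun s' _ => ?_
    rw [abs_mul, abs_of_nonneg (hP₁pos _ _ _)]
    exact mul_le_mul_of_nonneg_left (hmax _ _) (hP₁pos _ _ _)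
  have hD : |Q₂ s0 u0 - Qπ s0 u0| ≤ εR + γ * (εP * Vmid) + γ * |Q₂ s0 u0 - Qπ s0 u0| := by
    conv_lhs => rw [hdec]
    refine (abs_add_three _ _ _).trans ?_
    rw [abs_neg, abs_mul, abs_mul, abs_neg, abs_of_nonneg hγ0]
    exact add_le_add (add_le_add (hR s0) (mul_le_mul_of_nonneg_left hA hγ0))
      (mul_le_mul_of_nonneg_left hB hγ0)
  refine ciSup_le fun s => ciSup_le fun u => (hmax s u).trans ?_
  rw [le_div_iff₀ (by linarith)]
  linarith
end

section
/- (Transfer of optimal policy.) In the linear-dynamics setting, let (c^x, a^x) and (c^y, a^y) be two teams with linear rewards R_x, R_y and linear transition kernels P_x, P_y. Let Q_x, Q_y satisfy the Bellman optimality equations for (R_x,P_x) and (R_y,P_y) respectively with Q_y ≥ 0, let π_y : S → U be a greedy policy for Q_y, and let Q^{π_y} satisfy the policy-evaluation Bellman equation for π_y under (R_x, P_x). Set s_max = max_s ‖W_R φ(s)‖₁, V_mid = (1/2) max_{s,u} Q_y(s,u), and Ψ = ‖Σ_i a^x_i (c^x_i − c^y_i)‖_∞ + ‖Σ_i (a^x_i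 − a^y_i) c^y_i‖_∞. Then for any initial distribution ρ, with V*_x = Σ_s ρ(s) max_u Q_x(s,u) and V^{π_y}_x = Σ_s ρ(s) Q^{π_y}(s, π_y(s)), one has V*_x − V^{π_y}_x ≤ 2 ((s_max + γ d V_mid)/(γ(1 − γ))) · Ψ. -/
theorem contraction_aux {S U : Type*} [Fintype S] [Nonempty S] (γ : ℝ) (hγ0 : 0 < γ) (hγ1 : γ < 1)
    (P : S → U → S → ℝ) (hP : ∀ s u s', 0 ≤ P s u s') (hs : ∀ s u, ∑ s', P s u s' = 1)
    (f : S → ℝ) (ε : ℝ) (h : ∀ s, ∃ u, f s ≤ ε + γ * ∑ s', P s u s' * f s') (s : S) :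
    f s ≤ ε / (1 - γ) := by
  obtain ⟨s0, h0⟩ := Finite.exists_max f
  obtain ⟨u, hu⟩ := h s0
  have h1 : ∑ s', P s0 u s' * f s' ≤ f s0 := by
    calc _ ≤ ∑ s', P s0 u s' * f s0 :=
          Finset.sum_le_sum fun s' _ => mul_le_mul_of_nonneg_left (h0 s') (hP _ _ _)
      _ = f s0 := by rw [← Finset.sum_mul, hs, one_mul]
  have h2 := mul_le_mul_of_nonneg_left h1 hγ0.le
  rw [le_div_iff₀ (by linarith)]
  have h3 : f s * (1 - γ) ≤ f s0 * (1 - γ) :=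
    mul_le_mul_of_nonneg_right (h0 s) (by linarith)
  nlinarith

theorem abs_le_linf {d : ℕ} (x : Fin d → ℝ) (j : Fin d) : |x j| ≤ linf x :=
  le_ciSup (f := fun j => |x j|) (Set.finite_range _).bddAbove j

theorem diff_aux {d n : ℕ} (cx cy : Fin n → Fin d → ℝ) (ax ay : Fin n → ℝ) (w : Fin d → ℝ) :
    (∑ i, ax i * dot (cx i) w) - ∑ i, ay i * dot (cy i) w =
      ∑ j, ((∑ i, ax i * (cx i j - cy i j)) + ∑ i, (ax i - ay i) * cy i j) * w j := by
  simp only [dot, Finset.mul_sum, ← Finset.sum_sub_distrib, ← Finset.sum_add_distrib,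
    Finset.sum_mul]
  rw [Finset.sum_comm]
  refine Finset.sum_congr rfl fun j _ => Finset.sum_congr rfl fun i _ => ?_
  ring

theorem linf_nonneg {d : ℕ} (x : Fin d → ℝ) : 0 ≤ linf x :=
  Real.iSup_nonneg fun _ => abs_nonneg _

/-- Transfer of optimal policy: evaluating team `y`'s optimal greedy policy under
team `x`'s linear dynamics is at most `2 ((s_max + γ d V_mid)/(γ(1-γ))) Ψ`
suboptimal for team `x`. -/
theorem transfer_of_optimal_policy
    {S U : Type*} [Fintype S] [Nonempty S] [Fintype U] [Nonempty U]
    {k d n : ℕ} (γ : ℝ) (hγ0 : 0 < γ) (hγ1 : γ < 1)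
    (φ : S → Fin k → ℝ) (WR : Matrix (Fin d) (Fin k) ℝ)
    (WP : S → U → S → Fin d → ℝ)
    (hWPpos : ∀ s u s' j, 0 ≤ WP s u s' j)
    (hWPsum : ∀ s u (j : Fin d), ∑ s', WP s u s' j = 1)
    (cx cy : Fin n → Fin d → ℝ) (ax ay : Fin n → ℝ)
    (haxpos : ∀ i, 0 ≤ ax i) (haxsum : ∑ i, ax i = 1)
    (haypos : ∀ i, 0 ≤ ay i) (haysum : ∑ i, ay i = 1)
    (Rx Ry : S → ℝ) (Px Py : S → U → S → ℝ)
    (hRx : ∀ s, Rx s = ∑ i, ax i * dot (cx i) (WR.mulVec (φ s)))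
    (hRy : ∀ s, Ry s = ∑ i, ay i * dot (cy i) (WR.mulVec (φ s)))
    (hPx : ∀ s u s', Px s u s' = ∑ i, ax i * dot (cx i) (WP s u s'))
    (hPy : ∀ s u s', Py s u s' = ∑ i, ay i * dot (cy i) (WP s u s'))
    (hPxpos : ∀ s u s', 0 ≤ Px s u s') (hPxsum : ∀ s u, ∑ s', Px s u s' = 1)
    (hPypos : ∀ s u s', 0 ≤ Py s u s') (hPysum : ∀ s u, ∑ s', Py s u s' = 1)
    (Qx Qy : S → U → ℝ)
    (hQx : ∀ s u, Qx s u = Rx s + γ * ∑ s', Px s u s' * (⨆ u', Qx s' u'))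
    (hQy : ∀ s u, Qy s u = Ry s + γ * ∑ s', Py s u s' * (⨆ u', Qy s' u'))
    (hQypos : ∀ s u, 0 ≤ Qy s u)
    (πy : S → U) (hπy : ∀ s, Qy s (πy s) = ⨆ u, Qy s u)
    (Qπ : S → U → ℝ)
    (hQπ : ∀ s u, Qπ s u = Rx s + γ * ∑ s', Px s u s' * Qπ s' (πy s'))
    (ρ : S → ℝ) (hρpos : ∀ s, 0 ≤ ρ s) (hρsum : ∑ s, ρ s = 1) :
    (∑ s, ρ s * (⨆ u, Qx s u)) - ∑ s, ρ s * Qπ s (πy s) ≤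
      2 * (((⨆ s, l1 (WR.mulVec (φ s))) + γ * d * ((1/2) * ⨆ s, ⨆ u, Qy s u)) /
        (γ * (1 - γ))) *
      (linf (fun j => ∑ i, ax i * (cx i j - cy i j)) +
       linf (fun j => ∑ i, (ax i - ay i) * cy i j)) := by
  set Ψ := linf (fun j => ∑ i, ax i * (cx i j - cy i j)) +
       linf (fun j => ∑ i, (ax i - ay i) * cy i j) with hΨ
  set sm := ⨆ s, l1 (WR.mulVec (φ s)) with hsm
  set M := ⨆ s, ⨆ u, Qy s u with hM
  have hΨ0 : 0 ≤ Ψ := add_nonneg (linf_nonneg _) (linf_nonneg _)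
  have hsm0 : 0 ≤ sm := Real.iSup_nonneg fun _ => Finset.sum_nonneg fun _ _ => abs_nonneg _
  have hM0 : 0 ≤ M := Real.iSup_nonneg fun s => Real.iSup_nonneg fun u => hQypos s u
  have hVM : ∀ s, (⨆ u, Qy s u) ≤ M := fun s =>
    le_ciSup (f := fun s => ⨆ u, Qy s u) (Set.finite_range _).bddAbove s
  have hV0 : ∀ s, 0 ≤ ⨆ u, Qy s u := fun s => Real.iSup_nonneg fun u => hQypos s u
  have hQV : ∀ s u, Qy s u ≤ ⨆ u, Qy s u := fun s u =>
    le_ciSup (f := fun u => Qy s u) (Set.finite_range _).bddAbove u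
  obtain ⟨D, hD⟩ : ∃ D : Fin d → ℝ, D = fun j =>
    (∑ i, ax i * (cx i j - cy i j)) + ∑ i, (ax i - ay i) * cy i j := ⟨_, rfl⟩
  have hDΨ : ∀ j, |D j| ≤ Ψ := fun j => by
    rw [hD]
    exact (abs_add_le _ _).trans (add_le_add
      (abs_le_linf (fun j => ∑ i, ax i * (cx i j - cy i j)) j)
      (abs_le_linf (fun j => ∑ i, (ax i - ay i) * cy i j) j))
  have hR : ∀ s, |Rx s - Ry s| ≤ Ψ * sm := fun s => by
    have e : Rx s - Ry s = ∑ j, D j * (WR.mulVec (φ s)) j := by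
      rw [hRx, hRy, diff_aux, hD]
    rw [e]
    calc _ ≤ ∑ j, |D j * (WR.mulVec (φ s)) j| := Finset.abs_sum_le_sum_abs _ _
      _ ≤ ∑ j, Ψ * |(WR.mulVec (φ s)) j| := Finset.sum_le_sum fun j _ => by
          rw [abs_mul]; exact mul_le_mul_of_nonneg_right (hDΨ j) (abs_nonneg _)
      _ = Ψ * l1 (WR.mulVec (φ s)) := by rw [l1, Finset.mul_sum]
      _ ≤ _ := mul_le_mul_of_nonneg_left
          (le_ciSup (f := fun s => l1 (WR.mulVec (φ s))) (Set.finite_range _).bddAbove s) hΨ0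
  obtain ⟨V, hV⟩ : ∃ V : S → ℝ, V = fun s => ⨆ u, Qy s u := ⟨_, rfl⟩
  obtain ⟨X, hX⟩ : ∃ X : S → ℝ, X = fun s => ⨆ u, Qx s u := ⟨_, rfl⟩
  have hVs : ∀ s, (⨆ u, Qy s u) = V s := fun s => by rw [hV]
  have hXs : ∀ s, (⨆ u, Qx s u) = X s := fun s => by rw [hX]
  simp only [hVs] at hVM hV0 hQV hQy hπy
  simp only [hXs] at hQx ⊢
  have hP : ∀ s u, |∑ s', (Px s u s' - Py s u s') * V s'| ≤ d * (Ψ * (1/2 * M)) := fun s u => by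
    have e : ∑ s', (Px s u s' - Py s u s') * V s' =
        ∑ j, D j * ∑ s', WP s u s' j * (V s' - 1/2 * M) := by
      have e1 : ∑ s', (Px s u s' - Py s u s') * V s' =
          ∑ s', (Px s u s' - Py s u s') * (V s' - 1/2 * M) := by
        simp only [mul_sub, Finset.sum_sub_distrib, ← Finset.sum_mul, hPxsum, hPysum]
        ring
      rw [e1]
      simp only [hPx, hPy, diff_aux, Finset.mul_sum, Finset.sum_mul, hD]
      rw [Finset.sum_comm]
      simp only [mul_assoc]
    rw [e]
    calc _ ≤ ∑ j, |D j * ∑ s', WP s u s' j * (V s' - 1/2 * M)| :=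
          Finset.abs_sum_le_sum_abs _ _
      _ ≤ ∑ j : Fin d, Ψ * (1/2 * M) := Finset.sum_le_sum fun j _ => by
          rw [abs_mul]
          refine mul_le_mul (hDΨ j) ?_ (abs_nonneg _) hΨ0
          calc _ ≤ ∑ s', |WP s u s' j * (V s' - 1/2 * M)| := Finset.abs_sum_le_sum_abs _ _
            _ ≤ ∑ s', WP s u s' j * (1/2 * M) := Finset.sum_le_sum fun s' _ => by
                rw [abs_mul, abs_of_nonneg (hWPpos s u s' j)]
                refine mul_le_mul_of_nonneg_left ?_ (hWPpos s u s' j)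
                rw [abs_le]
                constructor <;> linarith [hVM s', hV0 s']
            _ = _ := by rw [← Finset.sum_mul, hWPsum, one_mul]
      _ = _ := by simp
  obtain ⟨ε, hε⟩ : ∃ ε, ε = Ψ * (sm + γ * d * (1/2 * M)) := ⟨_, rfl⟩
  have hstep : ∀ s u, |Rx s - Ry s + γ * ∑ s', (Px s u s' - Py s u s') * V s'| ≤ ε :=
    fun s u => by
      refine (abs_add_le _ _).trans ?_
      rw [abs_mul, abs_of_pos hγ0, hε]
      have := mul_le_mul_of_nonneg_left (hP s u) hγ0.le
      linarith [hR s]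
  have hA : ∀ s, X s - V s ≤ ε / (1 - γ) := by
    refine contraction_aux γ hγ0 hγ1 Px hPxpos hPxsum (fun s => X s - V s) ε fun s => ?_
    obtain ⟨u, hu⟩ := exists_eq_ciSup_of_finite (f := fun u => Qx s u)
    refine ⟨u, ?_⟩
    have h1 := (abs_le.mp (hstep s u)).2
    have h2 := hQx s u
    have h3 := hQy s u
    have h4 := hQV s u
    have h5 : Qx s u = X s := hu.trans (hXs s)
    simp only [sub_mul, mul_sub, Finset.sum_sub_distrib] at h1 ⊢
    linarith
  have hB : ∀ s, V s - Qπ s (πy s) ≤ ε / (1 - γ) := by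
    refine contraction_aux γ hγ0 hγ1 Px hPxpos hPxsum (fun s => V s - Qπ s (πy s)) ε fun s => ?_
    refine ⟨πy s, ?_⟩
    have h1 := (abs_le.mp (hstep s (πy s))).1
    have h2 := hQπ s (πy s)
    have h3 := hQy s (πy s)
    have h4 := hπy s
    simp only [sub_mul, mul_sub, Finset.sum_sub_distrib] at h1 ⊢
    linarith
  have hε0 : 0 ≤ ε := by rw [hε]; positivity
  have hfin : ε / (1 - γ) ≤ ε / (γ * (1 - γ)) := by
    have : 0 < 1 - γ := by linarith
    apply div_le_div_of_nonneg_left hε0 (by positivity)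
    nlinarith
  calc _ = ∑ s, ρ s * (X s - Qπ s (πy s)) := by
        rw [← Finset.sum_sub_distrib]; simp only [mul_sub]
    _ ≤ ∑ s, ρ s * (2 * (ε / (γ * (1 - γ)))) := Finset.sum_le_sum fun s _ =>
        mul_le_mul_of_nonneg_left (by linarith [hA s, hB s]) (hρpos s)
    _ = 2 * (ε / (γ * (1 - γ))) := by rw [← Finset.sum_mul, hρsum, one_mul]
    _ = _ := by rw [hε]; ring
end

section
/- (Population decrease bound.) In the linear-dynamics setting, let (c, a) be a team of n agents with aₙ < 1, and let (c, a⁻) be the team obtained by eliminating agent n and renormalizing: a⁻ᵢ = aᵢ/(1 − aₙ) for i ≤ n−1 and a⁻ₙ = 0. Let Q, Q⁻ satisfy the Bellman optimality equations for the linear dynamics of (c,a) and (c,a⁻) respectively, with Q ≥ 0, and set s_max = max_s ‖W_R φ(s)‖₁ and V_mid = (1/2) max_{s,u} Q(s,u). Then for any initial distribution ρ, the optimal values satisfy |V*_{(c,a⁻)} − V*_{(c,a)}| ≤ (aₙ (s_max + γ d V_mid)/(γ(1 − γ))) · ‖Σ_{i=1}^{n−1} aᵢ cᵢ/(1 − aₙ)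 − cₙ‖_∞. -/
/-- Population decrease bound: eliminating the last agent and renormalizing the
influence weights changes the optimal value by at most
`aₙ (s_max + γ d V_mid)/(γ(1-γ)) ‖Σ_{i<n} aᵢ cᵢ/(1-aₙ) - cₙ‖_∞`. -/
theorem population_decrease_bound
    {S U : Type*} [Fintype S] [Nonempty S] [Fintype U] [Nonempty U]
    {k d n : ℕ} (γ : ℝ) (hγ0 : 0 < γ) (hγ1 : γ < 1)
    (φ : S → Fin k → ℝ) (WR : Matrix (Fin d) (Fin k) ℝ)
    (WP : S → U → S → Fin d → ℝ)
    (hWPpos : ∀ s u s' j, 0 ≤ WP s u s' j)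
    (hWPsum : ∀ s u (j : Fin d), ∑ s', WP s u s' j = 1)
    (c : Fin (n + 1) → Fin d → ℝ) (a : Fin (n + 1) → ℝ)
    (hapos : ∀ i, 0 ≤ a i) (hasum : ∑ i, a i = 1) (han : a (Fin.last n) < 1)
    (a' : Fin (n + 1) → ℝ)
    (ha' : ∀ i : Fin n, a' i.castSucc = a i.castSucc / (1 - a (Fin.last n)))
    (ha'last : a' (Fin.last n) = 0)
    (R R' : S → ℝ) (P P' : S → U → S → ℝ)
    (hR : ∀ s, R s = ∑ i, a i * dot (c i) (WR.mulVec (φ s)))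
    (hR' : ∀ s, R' s = ∑ i, a' i * dot (c i) (WR.mulVec (φ s)))
    (hP : ∀ s u s', P s u s' = ∑ i, a i * dot (c i) (WP s u s'))
    (hP' : ∀ s u s', P' s u s' = ∑ i, a' i * dot (c i) (WP s u s'))
    (hPpos : ∀ s u s', 0 ≤ P s u s') (hPsum : ∀ s u, ∑ s', P s u s' = 1)
    (hP'pos : ∀ s u s', 0 ≤ P' s u s') (hP'sum : ∀ s u, ∑ s', P' s u s' = 1)
    (Q Q' : S → U → ℝ)
    (hQ : ∀ s u, Q s u = R s + γ * ∑ s', P s u s' * (⨆ u', Q s' u'))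
    (hQ' : ∀ s u, Q' s u = R' s + γ * ∑ s', P' s u s' * (⨆ u', Q' s' u'))
    (hQpos : ∀ s u, 0 ≤ Q s u)
    (ρ : S → ℝ) (hρpos : ∀ s, 0 ≤ ρ s) (hρsum : ∑ s, ρ s = 1) :
    |(∑ s, ρ s * (⨆ u, Q' s u)) - ∑ s, ρ s * (⨆ u, Q s u)| ≤
      a (Fin.last n) *
        ((⨆ s, l1 (WR.mulVec (φ s))) + γ * d * ((1/2) * ⨆ s, ⨆ u, Q s u)) /
        (γ * (1 - γ)) *
        linf (fun j =>
          (∑ i : Fin n, a i.castSucc / (1 - a (Fin.last n)) * c i.castSucc j) -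
            c (Fin.last n) j) := by
  have hbdd : ∀ f : U → ℝ, BddAbove (Set.range f) := fun f => (Set.finite_range f).bddAbove
  have hbddS : ∀ f : S → ℝ, BddAbove (Set.range f) := fun f => (Set.finite_range f).bddAbove
  set α := a (Fin.last n) with hα
  have hα0 : 0 ≤ α := hapos _
  have h1α : (1 - α) ≠ 0 := by linarith
  set δ : Fin d → ℝ := fun j =>
          (∑ i : Fin n, a i.castSucc / (1 - α) * c i.castSucc j) - c (Fin.last n) j with hδ
  set L := linf δ with hL
  have hδL : ∀ j, |δ j| ≤ L := fun j =>
    le_ciSup (f := fun j => |δ j|) (Set.finite_range _).bddAbove j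
  have hL0 : 0 ≤ L := Real.iSup_nonneg fun j => abs_nonneg _
  -- difference of the mixed inner products
  have key : ∀ w : Fin d → ℝ,
      (∑ i, a' i * dot (c i) w) - ∑ i, a i * dot (c i) w = α * ∑ j, δ j * w j := by
    intro w
    have h1 : ∑ j, δ j * w j
        = (∑ i : Fin n, a i.castSucc / (1 - α) * dot (c i.castSucc) w) - dot (c (Fin.last n)) w := by
      simp only [hδ, dot, sub_mul, Finset.sum_sub_distrib, Finset.sum_mul, Finset.mul_sum]
      rw [Finset.sum_comm]
      simp only [mul_assoc]
    rw [h1, Fin.sum_univ_castSucc, Fin.sum_univ_castSucc, ha'last, ← hα]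
    simp only [ha']
    have h2 : ∑ i : Fin n, a i.castSucc * dot (c i.castSucc) w
        = (1 - α) * ∑ i : Fin n, a i.castSucc / (1 - α) * dot (c i.castSucc) w := by
      rw [Finset.mul_sum]
      refine Finset.sum_congr rfl fun i _ => ?_
      field_simp
    rw [h2]
    ring
  have keyabs : ∀ w : Fin d → ℝ,
      |(∑ i, a' i * dot (c i) w) - ∑ i, a i * dot (c i) w| ≤ α * L * l1 w := by
    intro w
    rw [key, abs_mul, abs_of_nonneg hα0, mul_assoc]
    refine mul_le_mul_of_nonneg_left ?_ hα0
    refine (Finset.abs_sum_le_sum_abs _ _).trans ?_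
    rw [l1, Finset.mul_sum]
    refine Finset.sum_le_sum fun j _ => ?_
    rw [abs_mul]
    exact mul_le_mul_of_nonneg_right (hδL j) (abs_nonneg _)
  set sm := ⨆ s, l1 (WR.mulVec (φ s)) with hsm
  have hRd : ∀ s, |R' s - R s| ≤ α * L * sm := by
    intro s
    rw [hR, hR']
    refine (keyabs _).trans (mul_le_mul_of_nonneg_left ?_ (mul_nonneg hα0 hL0))
    exact le_ciSup (hbddS fun s => l1 (WR.mulVec (φ s))) s
  have hPd : ∀ s u, ∑ s', |P' s u s' - P s u s'| ≤ α * L * d := by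
    intro s u
    have h : ∀ s', |P' s u s' - P s u s'| ≤ α * L * ∑ j, WP s u s' j := by
      intro s'
      rw [hP, hP']
      refine (keyabs _).trans_eq ?_
      simp only [l1, abs_of_nonneg (hWPpos _ _ _ _)]
    refine (Finset.sum_le_sum fun s' _ => h s').trans_eq ?_
    rw [← Finset.mul_sum, Finset.sum_comm]
    simp [hWPsum]
  set V : S → ℝ := fun s => ⨆ u, Q s u with hV
  set V' : S → ℝ := fun s => ⨆ u, Q' s u with hV'
  change ∀ s u, Q s u = R s + γ * ∑ s', P s u s' * V s' at hQ
  change ∀ s u, Q' s u = R' s + γ * ∑ s', P' s u s' * V' s' at hQ'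
  change |(∑ s, ρ s * V' s) - ∑ s, ρ s * V s| ≤
    α * (sm + γ * d * (1 / 2 * ⨆ s, V s)) / (γ * (1 - γ)) * L
  set M := 1 / 2 * ⨆ s, V s with hM
  have hV0 : ∀ s, 0 ≤ V s := fun s => Real.iSup_nonneg fun u => hQpos s u
  have hVM : ∀ s, |V s - M| ≤ M := by
    intro s
    have h1 : V s ≤ ⨆ s, V s := le_ciSup (hbddS V) s
    have h2 := hV0 s
    rw [abs_le]
    constructor <;> linarith
  have hM0 : 0 ≤ M := (abs_nonneg _).trans (hVM (Classical.arbitrary S))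
  have hsm0 : 0 ≤ sm := Real.iSup_nonneg fun s => Finset.sum_nonneg fun j _ => abs_nonneg _
  have hPV : ∀ s u, |∑ s', (P' s u s' - P s u s') * V s'| ≤ α * L * d * M := by
    intro s u
    have h0 : ∑ s', (P' s u s' - P s u s') * V s'
        = ∑ s', (P' s u s' - P s u s') * (V s' - M) := by
      simp only [mul_sub, Finset.sum_sub_distrib, ← Finset.sum_mul, hPsum, hP'sum]
      ring
    rw [h0]
    refine (Finset.abs_sum_le_sum_abs _ _).trans ?_
    refine le_trans ?_ (mul_le_mul_of_nonneg_right (hPd s u) hM0)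
    rw [Finset.sum_mul]
    refine Finset.sum_le_sum fun s' _ => ?_
    rw [abs_mul]
    exact mul_le_mul_of_nonneg_left (hVM s') (abs_nonneg _)
  obtain ⟨s0, hs0⟩ := Finite.exists_max fun s => |V' s - V s|
  set D := |V' s0 - V s0| with hD
  set B := α * L * sm + γ * (α * L * d * M) with hB
  have hQd : ∀ s u, |Q' s u - Q s u| ≤ B + γ * D := by
    intro s u
    have h0 : Q' s u - Q s u = (R' s - R s) + γ * (∑ s', (P' s u s' - P s u s') * V s')
        + γ * ∑ s', P' s u s' * (V' s' - V s') := by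
      rw [hQ, hQ']
      simp only [mul_sub, sub_mul, Finset.sum_sub_distrib]
      ring
    have h1 : |∑ s', P' s u s' * (V' s' - V s')| ≤ D := by
      refine (Finset.abs_sum_le_sum_abs _ _).trans ?_
      calc _ ≤ ∑ s', P' s u s' * D := Finset.sum_le_sum fun s' _ => by
              rw [abs_mul, abs_of_nonneg (hP'pos s u s')]
              exact mul_le_mul_of_nonneg_left (hs0 s') (hP'pos s u s')
        _ = D := by rw [← Finset.sum_mul, hP'sum, one_mul]
    rw [h0]
    refine (abs_add_three _ _ _).trans ?_
    rw [abs_mul, abs_mul, abs_of_pos hγ0]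
    have h2 := mul_le_mul_of_nonneg_left h1 hγ0.le
    have h3 := mul_le_mul_of_nonneg_left (hPV s u) hγ0.le
    have h4 := hRd s
    rw [hB]
    linarith
  have hVd : ∀ s, |V' s - V s| ≤ B + γ * D := by
    intro s
    have h1 : V' s ≤ V s + (B + γ * D) := ciSup_le fun u => by
      have h2 : Q s u ≤ V s := le_ciSup (hbdd (Q s)) u
      have h3 := (abs_le.1 (hQd s u)).2
      linarith
    have h1' : V s ≤ V' s + (B + γ * D) := ciSup_le fun u => by
      have h2 : Q' s u ≤ V' s := le_ciSup (hbdd (Q' s)) u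
      have h3 := (abs_le.1 (hQd s u)).1
      linarith
    rw [abs_le]
    constructor <;> linarith
  have hD1 : D * (1 - γ) ≤ B := by
    have := hVd s0
    linarith
  have h1γ : 0 < 1 - γ := by linarith
  have hB0 : 0 ≤ B := by positivity
  have hfin : |(∑ s, ρ s * V' s) - ∑ s, ρ s * V s| ≤ D := by
    rw [← Finset.sum_sub_distrib]
    refine (Finset.abs_sum_le_sum_abs _ _).trans ?_
    calc _ ≤ ∑ s, ρ s * D := Finset.sum_le_sum fun s _ => by
            rw [← mul_sub, abs_mul, abs_of_nonneg (hρpos s)]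
            exact mul_le_mul_of_nonneg_left (hs0 s) (hρpos s)
      _ = D := by rw [← Finset.sum_mul, hρsum, one_mul]
  refine hfin.trans ?_
  have hE : α * (sm + γ * d * M) / (γ * (1 - γ)) * L = B / (γ * (1 - γ)) := by
    rw [hB]
    ring
  rw [hE, le_div_iff₀ (by positivity)]
  have hD0 : 0 ≤ D := abs_nonneg _
  have : γ * (D * (1 - γ)) ≤ 1 * (D * (1 - γ)) :=
    mul_le_mul_of_nonneg_right hγ1.le (by positivity)
  linarith
end

section
/- (Out-of-distribution performance.) In the linear-dynamics setting with a fixed influence weight vector a (nonnegative, summing to 1), let c be a target capability tuple and let M be a finite nonempty set of capability tuples. Let c^y ∈ M achieve the minimum of d_a(c, c') = ‖Σ_i a_i (c_i − c'_i)‖_∞ over c' ∈ M. Let Q_x, Q_y satisfy the Bellman optimality equations for the linear dynamics of (c, a) and (c^y, a) respectively with Q_y ≥ 0, let π_y be a greedy policy for Q_y, and let Q^{π_y} satisfy the policy-evaluation Bellman equation for π_y under the dynamics of (c, a). With s_max = max_s ‖W_R φ(s)‖₁ and V_mid = (1/2) max_{s,u} Q_y(s,u), for any initial distribution ρ: V*_{(c,a)}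 − V^{π_y}_{(c,a)} ≤ 2 ((s_max + γ d V_mid)/(γ(1 − γ))) · min_{c' ∈ M} ‖Σ_i a_i (c_i − c'_i)‖_∞, where V*_{(c,a)} = Σ_s ρ(s) max_u Q_x(s,u) and V^{π_y}_{(c,a)} = Σ_s ρ(s) Q^{π_y}(s, π_y(s)). -/
theorem contr_aux {S : Type*} [Fintype S] [Nonempty S] (γ ε : ℝ) (hγ1 : γ < 1) (D : S → ℝ)
    (h : ∀ B, (∀ s, D s ≤ B) → ∀ s, D s ≤ ε + γ * B) (s : S) : D s ≤ ε / (1 - γ) := by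
  obtain ⟨t, ht⟩ := Finite.exists_max D
  have h1 := h (D t) ht t
  refine (ht s).trans ?_
  rw [le_div_iff₀ (by linarith)]
  linarith

theorem lin_aux {d n : ℕ} (a : Fin n → ℝ) (c cy : Fin n → Fin d → ℝ) (w : Fin d → ℝ) :
    ∑ i, a i * dot (c i) w - ∑ i, a i * dot (cy i) w =
      ∑ j, (∑ i, a i * (c i j - cy i j)) * w j := by
  simp only [dot, Finset.mul_sum, Finset.sum_mul]
  rw [Finset.sum_comm, Finset.sum_comm (s := Finset.univ (α := Fin n)), ← Finset.sum_sub_distrib]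
  refine Finset.sum_congr rfl fun j _ => ?_
  rw [← Finset.sum_sub_distrib]
  refine Finset.sum_congr rfl fun i _ => ?_
  ring

/-- Out-of-distribution performance: the absolute-oracle policy (the optimal policy of
the closest in-distribution capability tuple under `d_a`) is at most
`2 ((s_max + γ d V_mid)/(γ(1-γ))) · min_{c' ∈ M} d_a(c, c')` suboptimal on `(c, a)`. -/
theorem out_of_distribution_performance
    {S U : Type*} [Fintype S] [Nonempty S] [Fintype U] [Nonempty U]
    {k d n : ℕ} (γ : ℝ) (hγ0 : 0 < γ) (hγ1 : γ < 1)
    (φ : S → Fin k → ℝ) (WR : Matrix (Fin d) (Fin k) ℝ)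
    (WP : S → U → S → Fin d → ℝ)
    (hWPpos : ∀ s u s' j, 0 ≤ WP s u s' j)
    (hWPsum : ∀ s u (j : Fin d), ∑ s', WP s u s' j = 1)
    (a : Fin n → ℝ) (hapos : ∀ i, 0 ≤ a i) (hasum : ∑ i, a i = 1)
    (c : Fin n → Fin d → ℝ)
    (M : Finset (Fin n → Fin d → ℝ)) (hM : M.Nonempty)
    (cy : Fin n → Fin d → ℝ) (hcyM : cy ∈ M)
    (hcymin : linf (fun j => ∑ i, a i * (c i j - cy i j)) =
      M.inf' hM fun c' => linf (fun j => ∑ i, a i * (c i j - c' i j)))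
    (Rx Ry : S → ℝ) (Px Py : S → U → S → ℝ)
    (hRx : ∀ s, Rx s = ∑ i, a i * dot (c i) (WR.mulVec (φ s)))
    (hRy : ∀ s, Ry s = ∑ i, a i * dot (cy i) (WR.mulVec (φ s)))
    (hPx : ∀ s u s', Px s u s' = ∑ i, a i * dot (c i) (WP s u s'))
    (hPy : ∀ s u s', Py s u s' = ∑ i, a i * dot (cy i) (WP s u s'))
    (hPxpos : ∀ s u s', 0 ≤ Px s u s') (hPxsum : ∀ s u, ∑ s', Px s u s' = 1)
    (hPypos : ∀ s u s', 0 ≤ Py s u s') (hPysum : ∀ s u, ∑ s', Py s u s' = 1)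
    (Qx Qy : S → U → ℝ)
    (hQx : ∀ s u, Qx s u = Rx s + γ * ∑ s', Px s u s' * (⨆ u', Qx s' u'))
    (hQy : ∀ s u, Qy s u = Ry s + γ * ∑ s', Py s u s' * (⨆ u', Qy s' u'))
    (hQypos : ∀ s u, 0 ≤ Qy s u)
    (πy : S → U) (hπy : ∀ s, Qy s (πy s) = ⨆ u, Qy s u)
    (Qπ : S → U → ℝ)
    (hQπ : ∀ s u, Qπ s u = Rx s + γ * ∑ s', Px s u s' * Qπ s' (πy s'))
    (ρ : S → ℝ) (hρpos : ∀ s, 0 ≤ ρ s) (hρsum : ∑ s, ρ s = 1) :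
    (∑ s, ρ s * (⨆ u, Qx s u)) - ∑ s, ρ s * Qπ s (πy s) ≤
      2 * (((⨆ s, l1 (WR.mulVec (φ s))) + γ * d * ((1/2) * ⨆ s, ⨆ u, Qy s u)) /
        (γ * (1 - γ))) *
      (M.inf' hM fun c' => linf (fun j => ∑ i, a i * (c i j - c' i j))) := by
  rw [← hcymin]
  set δ : ℝ := linf (fun j => ∑ i, a i * (c i j - cy i j)) with hδ
  set sm : ℝ := ⨆ s, l1 (WR.mulVec (φ s)) with hsm
  set G : ℝ := ⨆ s, ⨆ u, Qy s u with hG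
  have hΔ : ∀ j, |∑ i, a i * (c i j - cy i j)| ≤ δ := fun j =>
    le_ciSup (f := fun j => |∑ i, a i * (c i j - cy i j)|) (Finite.bddAbove_range _) j
  have hδ0 : 0 ≤ δ := Real.iSup_nonneg fun j => abs_nonneg _
  have hs : ∀ s, l1 (WR.mulVec (φ s)) ≤ sm := fun s =>
    le_ciSup (f := fun s => l1 (WR.mulVec (φ s))) (Finite.bddAbove_range _) s
  have hsm0 : 0 ≤ sm := Real.iSup_nonneg fun s => Finset.sum_nonneg fun j _ => abs_nonneg _
  have hVG : ∀ s, (⨆ u, Qy s u) ≤ G := fun s =>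
    le_ciSup (f := fun s => ⨆ u, Qy s u) (Finite.bddAbove_range _) s
  have hV0 : ∀ s, 0 ≤ ⨆ u, Qy s u := fun s => Real.iSup_nonneg (hQypos s)
  have hG0 : 0 ≤ G := Real.iSup_nonneg hV0
  set ε : ℝ := δ * (sm + γ * d * ((1/2) * G)) with hε
  have hε0 : 0 ≤ ε := by positivity
  have hR : ∀ s, |Rx s - Ry s| ≤ δ * sm := by
    intro s
    rw [hRx, hRy, lin_aux]
    calc _ ≤ ∑ j, |(∑ i, a i * (c i j - cy i j)) * (WR.mulVec (φ s)) j| :=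
          Finset.abs_sum_le_sum_abs _ _
      _ ≤ ∑ j, δ * |(WR.mulVec (φ s)) j| := by
          refine Finset.sum_le_sum fun j _ => ?_
          rw [abs_mul]
          exact mul_le_mul_of_nonneg_right (hΔ j) (abs_nonneg _)
      _ = δ * l1 (WR.mulVec (φ s)) := by rw [l1, Finset.mul_sum]
      _ ≤ δ * sm := mul_le_mul_of_nonneg_left (hs s) hδ0
  have hP : ∀ s u, |∑ s', Px s u s' * (⨆ u', Qy s' u') - ∑ s', Py s u s' * (⨆ u', Qy s' u')|
      ≤ δ * (d * ((1/2) * G)) := by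
    intro s u
    have e : ∑ s', Px s u s' * (⨆ u', Qy s' u') - ∑ s', Py s u s' * (⨆ u', Qy s' u') =
        ∑ s', (Px s u s' - Py s u s') * ((⨆ u', Qy s' u') - (1/2) * G) := by
      have h1 : ∑ s', (Px s u s' - Py s u s') * ((1/2) * G) = 0 := by
        rw [← Finset.sum_mul, Finset.sum_sub_distrib, hPxsum, hPysum]; ring
      simp only [mul_sub]
      rw [Finset.sum_sub_distrib, h1]
      simp only [sub_mul]
      rw [Finset.sum_sub_distrib, sub_zero]
    rw [e]
    have hd : ∀ s', |Px s u s' - Py s u s'| ≤ ∑ j, δ * WP s u s' j := by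
      intro s'
      rw [hPx, hPy, lin_aux]
      refine (Finset.abs_sum_le_sum_abs _ _).trans (Finset.sum_le_sum fun j _ => ?_)
      rw [abs_mul, abs_of_nonneg (hWPpos s u s' j)]
      exact mul_le_mul_of_nonneg_right (hΔ j) (hWPpos s u s' j)
    calc _ ≤ ∑ s', |(Px s u s' - Py s u s') * ((⨆ u', Qy s' u') - (1/2) * G)| :=
          Finset.abs_sum_le_sum_abs _ _
      _ ≤ ∑ s', (∑ j, δ * WP s u s' j) * ((1/2) * G) := by
          refine Finset.sum_le_sum fun s' _ => ?_
          rw [abs_mul]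
          have h2 : |(⨆ u', Qy s' u') - (1/2) * G| ≤ (1/2) * G := by
            rw [abs_le]
            constructor <;> linarith [hV0 s', hVG s']
          exact mul_le_mul (hd s') h2 (abs_nonneg _) ((abs_nonneg _).trans (hd s'))
      _ = δ * (d * ((1/2) * G)) := by
          rw [← Finset.sum_mul, Finset.sum_comm]
          simp only [← Finset.mul_sum, hWPsum]
          simp
          ring
  have hE : ∀ s u, |Rx s + γ * ∑ s', Px s u s' * (⨆ u', Qy s' u') - Qy s u| ≤ ε := by
    intro s u
    have h1 := abs_le.mp (hR s)
    have h2 := abs_le.mp (hP s u)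
    have h3 := mul_le_mul_of_nonneg_left h2.1 hγ0.le
    have h4 := mul_le_mul_of_nonneg_left h2.2 hγ0.le
    rw [hQy s u, abs_le]
    constructor <;> linarith [h1.1, h1.2]
  have hav : ∀ (f g : S → ℝ) (B : ℝ), (∀ s, f s - g s ≤ B) → ∀ s u,
      γ * ∑ s', Px s u s' * f s' - γ * ∑ s', Px s u s' * g s' ≤ γ * B := by
    intro f g B hB s u
    rw [← mul_sub, ← Finset.sum_sub_distrib]
    refine mul_le_mul_of_nonneg_left ?_ hγ0.le
    calc _ ≤ ∑ s', Px s u s' * B := by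
          refine Finset.sum_le_sum fun s' _ => ?_
          rw [← mul_sub]
          exact mul_le_mul_of_nonneg_left (hB s') (hPxpos s u s')
      _ = B := by rw [← Finset.sum_mul, hPxsum, one_mul]
  have hA := contr_aux γ ε hγ1 (fun s => (⨆ u, Qx s u) - ⨆ u, Qy s u) (by
    intro B hB s
    have : (⨆ u, Qx s u) ≤ ε + γ * B + ⨆ u, Qy s u := by
      refine ciSup_le fun u => ?_
      have h1 := hav _ _ B hB s u
      have h2 := abs_le.mp (hE s u)
      have h3 : Qy s u ≤ ⨆ u, Qy s u := le_ciSup (Finite.bddAbove_range _) u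
      linarith [hQx s u, h2.2]
    linarith)
  have hC := contr_aux γ ε hγ1 (fun s => (⨆ u, Qy s u) - Qπ s (πy s)) (by
    intro B hB s
    have h1 := hav _ _ B hB s (πy s)
    have h2 := abs_le.mp (hE s (πy s))
    linarith [hQπ s (πy s), h2.1, hπy s])
  have hfin : (∑ s, ρ s * (⨆ u, Qx s u)) - ∑ s, ρ s * Qπ s (πy s) ≤ 2 * (ε / (1 - γ)) := by
    rw [← Finset.sum_sub_distrib]
    calc _ ≤ ∑ s, ρ s * (2 * (ε / (1 - γ))) := by
          refine Finset.sum_le_sum fun s _ => ?_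
          rw [← mul_sub]
          exact mul_le_mul_of_nonneg_left (by linarith [hA s, hC s]) (hρpos s)
      _ = _ := by rw [← Finset.sum_mul, hρsum, one_mul]
  refine hfin.trans ?_
  have h1g : 0 < 1 - γ := by linarith
  have : ε / (1 - γ) ≤ ε / (γ * (1 - γ)) :=
    div_le_div_of_nonneg_left hε0 (by positivity) (by nlinarith)
  calc 2 * (ε / (1 - γ)) ≤ 2 * (ε / (γ * (1 - γ))) := by linarith
    _ = _ := by rw [hε]; ring
end

section
/- (Error from estimation of capabilities.) In the linear-dynamics setting, let (c, a) be a team of n agents and let ĉ be inaccurately inferred capabilities with max_i ‖c_i − ĉ_i‖_∞ ≤ ε_T. Let Q satisfy the Bellman optimality equation for the linear dynamics of (c,a), let Q̂ satisfy the Bellman optimality equation for the linear dynamics of (ĉ,a) with Q̂ ≥ 0, let π̂ be a greedy policy for Q̂, and let Q^{π̂} satisfy the policy-evaluation Bellman equation for π̂ under the dynamics of (c,a). With s_max = max_s ‖W_R φ(s)‖₁ and V_mid = (1/2) max_{s,u} Q̂(s,u), for any initial distribution ρ: Σ_s ρ(s) max_u Q(s,u) − Σ_s ρ(s) Q^{π̂}(s,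 π̂(s)) ≤ 2 ε_T (s_max + γ d V_mid)/(γ(1 − γ)). -/
theorem aux_contract {S U : Type*} [Fintype S] [Nonempty S] (γ δ : ℝ) (hγ0 : 0 < γ) (hγ1 : γ < 1)
    (P : S → U → S → ℝ) (hPpos : ∀ s u s', 0 ≤ P s u s') (hPsum : ∀ s u, ∑ s', P s u s' = 1)
    (f : S → ℝ) (hf : ∀ s, ∃ u, f s ≤ δ + γ * ∑ s', P s u s' * f s') (s : S) :
    f s ≤ δ / (1 - γ) := by
  obtain ⟨m, hm⟩ := Finite.exists_max f
  obtain ⟨u, hu⟩ := hf m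
  have h1 : ∑ s', P m u s' * f s' ≤ f m := by
    calc ∑ s', P m u s' * f s' ≤ ∑ s', P m u s' * f m :=
          Finset.sum_le_sum fun x _ => mul_le_mul_of_nonneg_left (hm x) (hPpos _ _ _)
      _ = f m := by rw [← Finset.sum_mul, hPsum, one_mul]
  refine (hm s).trans ?_
  rw [le_div_iff₀ (by linarith)]
  nlinarith

theorem aux_dot {d n : ℕ} (c chat : Fin n → Fin d → ℝ) (a : Fin n → ℝ)
    (hapos : ∀ i, 0 ≤ a i) (hasum : ∑ i, a i = 1)
    (εT : ℝ) (hest : ∀ i, linf (fun m => c i m - chat i m) ≤ εT) (w : Fin d → ℝ) :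
    |∑ i, a i * dot (c i) w - ∑ i, a i * dot (chat i) w| ≤ εT * l1 w := by
  have hb : ∀ i j, |c i j - chat i j| ≤ εT := fun i j =>
    (le_ciSup (f := fun j => |c i j - chat i j|) (Set.finite_range _).bddAbove j).trans (hest i)
  rw [← Finset.sum_sub_distrib]
  calc |∑ i, (a i * dot (c i) w - a i * dot (chat i) w)|
      ≤ ∑ i, |a i * dot (c i) w - a i * dot (chat i) w| := Finset.abs_sum_le_sum_abs _ _
    _ ≤ ∑ i, a i * (εT * l1 w) := by
        refine Finset.sum_le_sum fun i _ => ?_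
        rw [← mul_sub, abs_mul, abs_of_nonneg (hapos i)]
        refine mul_le_mul_of_nonneg_left ?_ (hapos i)
        unfold dot l1
        rw [← Finset.sum_sub_distrib, Finset.mul_sum]
        refine (Finset.abs_sum_le_sum_abs _ _).trans (Finset.sum_le_sum fun j _ => ?_)
        rw [← sub_mul, abs_mul]
        exact mul_le_mul_of_nonneg_right (hb i j) (abs_nonneg _)
    _ = εT * l1 w := by rw [← Finset.sum_mul, hasum, one_mul]

/-- Error from estimation of capabilities: if the capabilities are inferred with
ℓ^∞ error at most `ε_T` per agent, the greedy policy of the inferred model is at most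
`2 ε_T (s_max + γ d V_mid)/(γ(1-γ))` suboptimal on the true dynamics. -/
theorem capability_estimation_error_bound
    {S U : Type*} [Fintype S] [Nonempty S] [Fintype U] [Nonempty U]
    {k d n : ℕ} (γ : ℝ) (hγ0 : 0 < γ) (hγ1 : γ < 1)
    (φ : S → Fin k → ℝ) (WR : Matrix (Fin d) (Fin k) ℝ)
    (WP : S → U → S → Fin d → ℝ)
    (hWPpos : ∀ s u s' j, 0 ≤ WP s u s' j)
    (hWPsum : ∀ s u (j : Fin d), ∑ s', WP s u s' j = 1)
    (c chat : Fin n → Fin d → ℝ) (a : Fin n → ℝ)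
    (hapos : ∀ i, 0 ≤ a i) (hasum : ∑ i, a i = 1)
    (εT : ℝ) (hest : ∀ i, linf (fun m => c i m - chat i m) ≤ εT)
    (R Rhat : S → ℝ) (P Phat : S → U → S → ℝ)
    (hR : ∀ s, R s = ∑ i, a i * dot (c i) (WR.mulVec (φ s)))
    (hRhat : ∀ s, Rhat s = ∑ i, a i * dot (chat i) (WR.mulVec (φ s)))
    (hP : ∀ s u s', P s u s' = ∑ i, a i * dot (c i) (WP s u s'))
    (hPhat : ∀ s u s', Phat s u s' = ∑ i, a i * dot (chat i) (WP s u s'))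
    (hPpos : ∀ s u s', 0 ≤ P s u s') (hPsum : ∀ s u, ∑ s', P s u s' = 1)
    (hPhatpos : ∀ s u s', 0 ≤ Phat s u s') (hPhatsum : ∀ s u, ∑ s', Phat s u s' = 1)
    (Q Qhat : S → U → ℝ)
    (hQ : ∀ s u, Q s u = R s + γ * ∑ s', P s u s' * (⨆ u', Q s' u'))
    (hQhat : ∀ s u, Qhat s u = Rhat s + γ * ∑ s', Phat s u s' * (⨆ u', Qhat s' u'))
    (hQhatpos : ∀ s u, 0 ≤ Qhat s u)
    (πhat : S → U) (hπhat : ∀ s, Qhat s (πhat s) = ⨆ u, Qhat s u)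
    (Qπ : S → U → ℝ)
    (hQπ : ∀ s u, Qπ s u = R s + γ * ∑ s', P s u s' * Qπ s' (πhat s'))
    (ρ : S → ℝ) (hρpos : ∀ s, 0 ≤ ρ s) (hρsum : ∑ s, ρ s = 1) :
    (∑ s, ρ s * (⨆ u, Q s u)) - ∑ s, ρ s * Qπ s (πhat s) ≤
      2 * εT * ((⨆ s, l1 (WR.mulVec (φ s))) + γ * d * ((1/2) * ⨆ s, ⨆ u, Qhat s u)) /
        (γ * (1 - γ)) := by
  have hε : 0 ≤ εT := by
    have : Nonempty (Fin n) := by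
      by_contra h
      rw [not_nonempty_iff] at h
      simp at hasum
    obtain ⟨i⟩ := this
    exact (Real.iSup_nonneg fun j => abs_nonneg _).trans (hest i)
  set smax := ⨆ s, l1 (WR.mulVec (φ s)) with hsmax
  set M := (1/2) * ⨆ s, ⨆ u, Qhat s u with hM
  set Vh : S → ℝ := fun s => ⨆ u, Qhat s u with hVh
  set V : S → ℝ := fun s => ⨆ u, Q s u with hV
  have hVh0 : ∀ s, 0 ≤ Vh s := fun s => Real.iSup_nonneg fun u => hQhatpos s u
  have hVhM : ∀ s, Vh s ≤ 2 * M := fun s => by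
    have := le_ciSup (f := Vh) (Set.finite_range _).bddAbove s
    rw [hM]; linarith
  have hQV : ∀ s u, Qhat s u ≤ Vh s := fun s u =>
    le_ciSup (f := fun u => Qhat s u) (Set.finite_range _).bddAbove u
  have hM0 : 0 ≤ M := by
    have s := Classical.arbitrary S
    linarith [hVh0 s, hVhM s]
  have hs0 : 0 ≤ smax := Real.iSup_nonneg fun s => Finset.sum_nonneg fun j _ => abs_nonneg _
  have hRR : ∀ s, |R s - Rhat s| ≤ εT * smax := fun s => by
    rw [hR, hRhat]
    refine (aux_dot c chat a hapos hasum εT hest _).trans ?_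
    exact mul_le_mul_of_nonneg_left
      (le_ciSup (f := fun s => l1 (WR.mulVec (φ s))) (Set.finite_range _).bddAbove s) hε
  have hPP : ∀ s u, |∑ s', P s u s' * Vh s' - ∑ s', Phat s u s' * Vh s'| ≤ εT * d * M := by
    intro s u
    have e : ∑ s', P s u s' * Vh s' - ∑ s', Phat s u s' * Vh s'
        = ∑ s', (P s u s' - Phat s u s') * (Vh s' - M) := by
      simp only [sub_mul, mul_sub, Finset.sum_sub_distrib, ← Finset.sum_mul, hPsum, hPhatsum]
      ring
    rw [e]
    calc _ ≤ ∑ s', |(P s u s' - Phat s u s') * (Vh s' - M)| := Finset.abs_sum_le_sum_abs _ _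
      _ ≤ ∑ s', (εT * l1 (WP s u s')) * M := by
        refine Finset.sum_le_sum fun s' _ => ?_
        rw [abs_mul]
        have h1 : |P s u s' - Phat s u s'| ≤ εT * l1 (WP s u s') := by
          rw [hP, hPhat]
          exact aux_dot c chat a hapos hasum εT hest _
        have h2 : |Vh s' - M| ≤ M := by
          rw [abs_le]; constructor <;> linarith [hVh0 s', hVhM s']
        exact mul_le_mul h1 h2 (abs_nonneg _) ((abs_nonneg _).trans h1)
      _ = εT * d * M := by
        rw [← Finset.sum_mul, ← Finset.mul_sum]
        congr 2
        unfold l1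
        rw [Finset.sum_comm]
        simp [abs_of_nonneg (hWPpos _ _ _ _), hWPsum]
  set δ := εT * (smax + γ * d * M) with hδ
  have hδ0 : 0 ≤ δ := by positivity
  have hres : ∀ s u, |(R s + γ * ∑ s', P s u s' * Vh s') - Qhat s u| ≤ δ := fun s u => by
    rw [hQhat s u]
    have h1 := abs_le.1 (hRR s)
    have h2 := abs_le.1 (hPP s u)
    change |(R s + γ * ∑ s', P s u s' * Vh s') - (Rhat s + γ * ∑ s', Phat s u s' * Vh s')| ≤ δ
    rw [hδ, abs_le]
    constructor <;> nlinarith [mul_le_mul_of_nonneg_left h2.1 hγ0.le,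
      mul_le_mul_of_nonneg_left h2.2 hγ0.le]
  have hA : ∀ s, V s - Vh s ≤ δ / (1 - γ) := by
    refine aux_contract γ δ hγ0 hγ1 P hPpos hPsum (fun s => V s - Vh s) fun s => ?_
    obtain ⟨u, hu⟩ := exists_eq_ciSup_of_finite (f := fun u => Q s u)
    refine ⟨u, ?_⟩
    have h1 : V s = R s + γ * ∑ s', P s u s' * V s' := hu.symm.trans (hQ s u)
    have h2 := abs_le.1 (hres s u)
    have h3 := hQV s u
    simp only [mul_sub, Finset.sum_sub_distrib]
    linarith [h2.2]
  have hB : ∀ s, Vh s - Qπ s (πhat s) ≤ δ / (1 - γ) := by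
    refine aux_contract γ δ hγ0 hγ1 P hPpos hPsum (fun s => Vh s - Qπ s (πhat s)) fun s => ?_
    refine ⟨πhat s, ?_⟩
    have h1 := hQπ s (πhat s)
    have h2 := abs_le.1 (hres s (πhat s))
    have h3 : Qhat s (πhat s) = Vh s := hπhat s
    simp only [mul_sub, Finset.sum_sub_distrib]
    linarith [h2.1]
  have hC : (∑ s, ρ s * V s) - ∑ s, ρ s * Qπ s (πhat s) ≤ 2 * (δ / (1 - γ)) := by
    rw [← Finset.sum_sub_distrib]
    calc _ ≤ ∑ s, ρ s * (2 * (δ / (1 - γ))) := by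
          refine Finset.sum_le_sum fun s _ => ?_
          rw [← mul_sub]
          exact mul_le_mul_of_nonneg_left (by linarith [hA s, hB s]) (hρpos s)
      _ = _ := by rw [← Finset.sum_mul, hρsum, one_mul]
  refine hC.trans ?_
  have h1g : 0 < 1 - γ := by linarith
  have e : 2 * εT * (smax + γ * d * M) = 2 * δ := by rw [hδ]; ring
  rw [e, ← mul_div_assoc]
  exact div_le_div_of_nonneg_left (by positivity) (by positivity) (by nlinarith)
end
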